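/- arXiv:2511.04418 — 4 statements merged into one kernel-verified Lean document; each statement's English description precedes it below -/
import Mathlib

section
/- (Non-identifiability of epistemic uncertainty.) Let K ≥ 2 and let p be a probability vector on K classes with p i > 0 for every i. Then there exist probability vectors q₁ and q₂ on K classes such that KL(q₁‖p) = 0 and KL(q₂‖p) = -Real.log (min over i of p i), and moreover -Real.log (min over i of p i) ≥ Real.log K. Hence the same predictive distribution p is compatible both with zero epistemic uncertainty and with epistemic uncertainty at least log K. -/
/-- A probability vector on `K` classes. -/
def IsProbVec {K : ℕ} (p : Fin K → ℝ) : Prop :=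
  (∀ i, 0 ≤ p i) ∧ ∑ i, p i = 1

/-- Kullback–Leibler divergence; summands with `q i = 0` vanish automatically. -/
noncomputable def klDiv {K : ℕ} (q p : Fin K → ℝ) : ℝ :=
  ∑ i, q i * Real.log (q i / p i)

/-- Non-identifiability of epistemic uncertainty: the same predictive
distribution `p` is compatible both with zero EU and with EU at least `log K`. -/
theorem nonidentifiability_of_EU {K : ℕ} (hK : 2 ≤ K)
    (p : Fin K → ℝ) (hp : IsProbVec p) (hpos : ∀ i, 0 < p i) :
    ∃ q₁ q₂ : Fin K → ℝ, IsProbVec q₁ ∧ IsProbVec q₂ ∧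
      klDiv q₁ p = 0 ∧
      klDiv q₂ p =
        -Real.log (Finset.univ.inf' (Finset.univ_nonempty_iff.mpr ⟨⟨0, by omega⟩⟩) p) ∧
      Real.log K ≤
        -Real.log (Finset.univ.inf' (Finset.univ_nonempty_iff.mpr ⟨⟨0, by omega⟩⟩) p) := by
  have hne : (Finset.univ : Finset (Fin K)).Nonempty :=
    Finset.univ_nonempty_iff.mpr ⟨⟨0, by omega⟩⟩
  obtain ⟨j, -, hj⟩ := Finset.exists_mem_eq_inf' hne p
  have hmin : ∀ i, p j ≤ p i := fun i => by
    rw [← hj]; exact Finset.inf'_le p (Finset.mem_univ i)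
  have hK0 : (0 : ℝ) < K := by
    have : 0 < K := by omega
    exact_mod_cast this
  refine ⟨p, fun i => if i = j then 1 else 0, hp, ⟨fun i => ?_, ?_⟩, ?_, ?_, ?_⟩
  · dsimp only
    split_ifs <;> norm_num
  · simp
  · unfold klDiv
    refine Finset.sum_eq_zero fun i _ => ?_
    rw [div_self (hpos i).ne']
    simp
  · rw [hj]
    unfold klDiv
    simp
  · rw [hj, ← Real.log_inv]
    apply Real.log_le_log hK0
    have hsum : (K : ℝ) * p j ≤ 1 := by
      have h := Finset.sum_le_sum (fun i (_ : i ∈ (Finset.univ : Finset (Fin K))) => hmin i)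
      rw [hp.2] at h
      simpa using h
    rw [← one_div, le_div_iff₀ (hpos j)]
    exact hsum
end

section
/- (Maximal entropy given the largest coordinate.) Let K ≥ 2 and let p be a probability vector on K classes, and let α = max over i of p i. Then H(p) ≤ H_max(α), i.e. H(p) ≤ -(α * Real.log α) - ((1 - α) * Real.log (1 - α)) + (1 - α) * Real.log (K - 1), with the convention 0 * log 0 = 0. -/
/-- Shannon entropy, with the convention `0 * log 0 = 0`. -/
noncomputable def entropy {K : ℕ} (p : Fin K → ℝ) : ℝ :=
  ∑ i, -(p i * Real.log (p i))

/-- Maximal entropy given the largest coordinate `α`: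
`H(p) ≤ -(α log α) - ((1-α) log (1-α)) + (1-α) log (K-1)`. -/
theorem entropy_le_Hmax {K : ℕ} (hK : 2 ≤ K)
    (p : Fin K → ℝ) (hp : IsProbVec p) (α : ℝ)
    (hα : α = Finset.univ.sup' (Finset.univ_nonempty_iff.mpr ⟨⟨0, by omega⟩⟩) p) :
    entropy p ≤
      -(α * Real.log α) - ((1 - α) * Real.log (1 - α))
        + (1 - α) * Real.log ((K : ℝ) - 1) := by
  obtain ⟨h0, h1⟩ := hp
  obtain ⟨j, -, hj⟩ := Finset.exists_mem_eq_sup' (Finset.univ_nonempty_iff.mpr ⟨⟨0, by omega⟩⟩) p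
  have hαj : α = p j := hα.trans hj
  clear hα hj
  subst hαj
  have hsum : ∑ i ∈ Finset.univ.erase j, p i = 1 - p j := by
    rw [← h1, ← Finset.add_sum_erase _ p (Finset.mem_univ j)]; ring
  have hcard : ((Finset.univ.erase j).card : ℝ) = (K : ℝ) - 1 := by
    rw [Finset.card_erase_of_mem (Finset.mem_univ j), Finset.card_univ, Fintype.card_fin,
      Nat.cast_sub (by omega)]
    simp
  have hK1 : (0 : ℝ) < (K : ℝ) - 1 := by
    have : (2 : ℝ) ≤ K := by exact_mod_cast hK
    linarith
  unfold entropy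
  rw [← Finset.add_sum_erase _ _ (Finset.mem_univ j)]
  have hnn : 0 ≤ 1 - p j := by
    rw [← hsum]; exact Finset.sum_nonneg fun i _ => h0 i
  rcases hnn.eq_or_lt with he | hlt
  · have hz : ∀ i ∈ Finset.univ.erase j, p i = 0 :=
      (Finset.sum_eq_zero_iff_of_nonneg fun i _ => h0 i).1 (hsum.trans he.symm)
    have : ∑ i ∈ Finset.univ.erase j, -(p i * Real.log (p i)) = 0 :=
      Finset.sum_eq_zero fun i hi => by rw [hz i hi]; simp
    rw [this, ← he]; simp
  · have hc : 0 < (1 - p j) / ((K : ℝ) - 1) := div_pos hlt hK1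
    have hlog : Real.log ((1 - p j) / ((K : ℝ) - 1))
        = Real.log (1 - p j) - Real.log ((K : ℝ) - 1) := Real.log_div hlt.ne' hK1.ne'
    have hmul : ((K : ℝ) - 1) * ((1 - p j) / ((K : ℝ) - 1)) = 1 - p j := by
      field_simp
    generalize (1 - p j) / ((K : ℝ) - 1) = c at hc hlog hmul
    have key : ∀ i ∈ Finset.univ.erase j,
        -(p i * Real.log (p i)) ≤ c - p i * (1 + Real.log c) := by
      intro i _
      rcases (h0 i).eq_or_lt with hi | hi
      · rw [← hi]; simpa using hc.le
      · have h := Real.log_le_sub_one_of_pos (div_pos hc hi)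
        rw [Real.log_div hc.ne' hi.ne'] at h
        have h2 := mul_le_mul_of_nonneg_left h hi.le
        have h3 : p i * (c / p i - 1) = c - p i := by field_simp
        rw [h3] at h2
        linarith
    have hs := Finset.sum_le_sum key
    rw [Finset.sum_sub_distrib, ← Finset.sum_mul, hsum, Finset.sum_const, nsmul_eq_mul, hcard,
      hmul, hlog] at hs
    linarith
end

section
/- Let K ≥ 2 be an integer. The function α ↦ H_max(α) = -(α * Real.log α) - ((1 - α) * Real.log (1 - α)) + (1 - α) * Real.log (K - 1) is strictly antitone on the interval [1/K, 1], with H_max(1/K) = Real.log K and H_max(1) = 0; in particular, for every δ ∈ [0, Real.log K] there is a unique α_δ ∈ [1/K, 1] with H_max(α_δ) = δ. -/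
/-- `H_max(α) = -(α log α) - ((1-α) log ((1-α)/(K-1)))`,
with the convention `0 * log 0 = 0`. -/
noncomputable def Hmax (K : ℕ) (α : ℝ) : ℝ :=
  -(α * Real.log α) - ((1 - α) * Real.log ((1 - α) / ((K : ℝ) - 1)))

lemma Hmax_eq_qary (K : ℕ) (hK : 2 ≤ K) (α : ℝ) :
    Hmax K α = Real.qaryEntropy K (1 - α) := by
  have hK' : (2 : ℝ) ≤ K := by exact_mod_cast hK
  have h1 : ((K : ℝ) - 1) ≠ 0 := by linarith
  unfold Hmax Real.qaryEntropy
  rw [Real.binEntropy_one_sub, Real.binEntropy_eq_negMulLog_add_negMulLog_one_sub]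
  simp only [Real.negMulLog]
  push_cast
  by_cases h : 1 - α = 0
  · rw [h]; simp
  · rw [Real.log_div h h1]; ring

/-- `H_max` is strictly antitone on `[1/K, 1]`, with `H_max(1/K) = log K` and
`H_max(1) = 0`; in particular every `δ ∈ [0, log K]` is attained at a unique
`α_δ ∈ [1/K, 1]`. -/
theorem Hmax_strictAntiOn (K : ℕ) (hK : 2 ≤ K) :
    StrictAntiOn (Hmax K) (Set.Icc (1 / (K : ℝ)) 1) ∧
    Hmax K (1 / (K : ℝ)) = Real.log K ∧
    Hmax K 1 = 0 ∧
    ∀ δ ∈ Set.Icc (0 : ℝ) (Real.log K),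
      ∃! α, α ∈ Set.Icc (1 / (K : ℝ)) 1 ∧ Hmax K α = δ := by
  have hK' : (2 : ℝ) ≤ K := by exact_mod_cast hK
  have hfun : Hmax K = fun α => Real.qaryEntropy K (1 - α) := funext (Hmax_eq_qary K hK)
  have hanti : StrictAntiOn (Hmax K) (Set.Icc (1 / (K : ℝ)) 1) := by
    intro a ha b hb hab
    rw [Hmax_eq_qary K hK, Hmax_eq_qary K hK]
    apply Real.qaryEntropy_strictMonoOn hK
    · exact ⟨by linarith [hb.2], by linarith [hb.1]⟩
    · exact ⟨by linarith [ha.2], by linarith [ha.1]⟩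
    · linarith
  have h0 : Hmax K (1 / (K : ℝ)) = Real.log K := by
    have hk : (K : ℝ) ≠ 0 := by linarith
    have h1 : ((K : ℝ) - 1) ≠ 0 := by linarith
    have h2 : (1 - 1 / (K : ℝ)) / ((K : ℝ) - 1) = (K : ℝ)⁻¹ := by field_simp
    unfold Hmax
    rw [h2, one_div, Real.log_inv]
    ring
  have h1 : Hmax K 1 = 0 := by simp [Hmax]
  have hle : 1 / (K : ℝ) ≤ 1 := by
    rw [div_le_one (by linarith)]; linarith
  have hcont : Continuous (Hmax K) := by
    rw [hfun]
    exact Real.qaryEntropy_continuous.comp (continuous_const.sub continuous_id)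
  refine ⟨hanti, h0, h1, fun δ hδ => ?_⟩
  have := intermediate_value_Icc' hle hcont.continuousOn
  rw [h0, h1] at this
  obtain ⟨α, hα, hαδ⟩ := this hδ
  exact ⟨α, ⟨hα, hαδ⟩, fun β hβ => hanti.injOn hβ.1 hα (hβ.2.trans hαδ.symm)⟩
end

section
/- (Low entropy forces a dominant class.) Let K ≥ 2, let δ ∈ [0, Real.log 2], and let γ ∈ [1/2, 1] satisfy H_B(γ) = δ. Then every probability vector p on K classes with H(p) ≤ δ has a coordinate i with p i ≥ γ; i.e. the maximal coordinate of p is at least γ. -/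
/-- The binary entropy function, with the convention `0 * log 0 = 0`. -/
noncomputable def Hbin (x : ℝ) : ℝ :=
  -(x * Real.log x) - ((1 - x) * Real.log (1 - x))

lemma aux_mul_log {x c : ℝ} (hx : 0 ≤ x) (h : x ≤ c) : x * -Real.log c ≤ -(x * Real.log x) := by
  rcases hx.eq_or_lt with h0 | h0
  · simp [← h0]
  · have := mul_le_mul_of_nonneg_left (Real.log_le_log h0 h) hx
    linarith

/-- Low entropy forces a dominant class: if `H(p) ≤ δ = H_B(γ)` then some
coordinate of `p` is at least `γ`. -/
theorem low_entropy_dominant_class {K : ℕ} (hK : 2 ≤ K)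
    (δ : ℝ) (hδ : δ ∈ Set.Icc (0 : ℝ) (Real.log 2))
    (γ : ℝ) (hγ : γ ∈ Set.Icc (1 / 2 : ℝ) 1) (hHγ : Hbin γ = δ)
    (p : Fin K → ℝ) (hp : IsProbVec p) (hH : entropy p ≤ δ) :
    ∃ i, γ ≤ p i := by
  obtain ⟨h0, h1⟩ := hp
  haveI : Nonempty (Fin K) := ⟨⟨0, by omega⟩⟩
  obtain ⟨m, hm⟩ := Finite.exists_max p
  refine ⟨m, ?_⟩
  by_contra hlt
  push Not at hlt
  have hsum := Finset.add_sum_erase Finset.univ p (Finset.mem_univ m)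
  rw [h1] at hsum
  have hE : ∀ x, Hbin x = Real.binEntropy x := by
    intro x
    rw [Real.binEntropy_eq_negMulLog_add_negMulLog_one_sub]
    simp only [Hbin, Real.negMulLog]
    ring
  have hmpos : 0 < p m := by
    by_contra hn
    have : ∑ i, p i ≤ 0 := Finset.sum_nonpos fun i _ => (hm i).trans (not_lt.mp hn)
    linarith
  by_cases hhalf : 1 / 2 ≤ p m
  · have hent : Hbin (p m) ≤ entropy p := by
      unfold entropy Hbin
      rw [← Finset.add_sum_erase Finset.univ _ (Finset.mem_univ m)]
      have : ∑ i ∈ Finset.univ.erase m, p i * -Real.log (1 - p m)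
          ≤ ∑ i ∈ Finset.univ.erase m, -(p i * Real.log (p i)) := by
        refine Finset.sum_le_sum fun i hi => aux_mul_log (h0 i) ?_
        have := Finset.single_le_sum (f := p) (fun j _ => h0 j) hi
        linarith
      rw [← Finset.sum_mul] at this
      have e : ∑ i ∈ Finset.univ.erase m, p i = 1 - p m := by linarith
      rw [e] at this
      linarith
    have hs := Real.binEntropy_strictAntiOn (a := p m) (b := γ)
      ⟨by linarith, by linarith [hγ.2]⟩ ⟨by linarith [hγ.1], hγ.2⟩ hlt
    rw [← hE, ← hE] at hs
    linarith
  · push Not at hhalf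
    have : ∑ i, p i * -Real.log (p m) ≤ entropy p :=
      Finset.sum_le_sum fun i _ => aux_mul_log (h0 i) (hm i)
    rw [← Finset.sum_mul, h1] at this
    have hl := Real.log_lt_log hmpos hhalf
    rw [one_div, Real.log_inv] at hl
    linarith [hδ.2]
end
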